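/- arXiv:1501.03736 — 2 statements merged into one kernel-verified Lean document; each statement's English description precedes it below -/
import Mathlib

section
/- Let 1 ≤ k < n ≤ q, let x be an n-tuple of pairwise distinct elements of F_q and y an n-tuple of nonzero elements of F_q. If 2k - 1 ≤ n, then the square code GRS_k(x,y)² equals GRS_{2k-1}(x, y ⋆ y). -/
open Polynomial Matrix

noncomputable section

variable {F : Type*} [Field F]

/-- Star (componentwise) product code: span of all componentwise products. -/
def starProd {ι : Type*} (A B : Submodule F (ι → F)) : Submodule F (ι → F) :=
  Submodule.span F {v | ∃ a ∈ A, ∃ b ∈ B, v = a * b}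

/-- Evaluation map of polynomials with multipliers. -/
def GRSmap {ι : Type*} (x y : ι → F) : F[X] →ₗ[F] (ι → F) :=
  LinearMap.pi fun i => y i • (Polynomial.aeval (x i)).toLinearMap

/-- Generalized Reed–Solomon code. -/
def GRS {ι : Type*} (k : ℕ) (x y : ι → F) : Submodule F (ι → F) :=
  (Polynomial.degreeLT F k).map (GRSmap x y)

/-- Punctured code at a set `I` of positions. -/
def punct {n : ℕ} (I : Set (Fin n)) (C : Submodule F (Fin n → F)) :
    Submodule F ({i : Fin n // i ∉ I} → F) :=
  C.map (LinearMap.funLeft F F Subtype.val)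

/-- Vectors vanishing on all positions of `I`. -/
def zeroOn {n : ℕ} (I : Set (Fin n)) : Submodule F (Fin n → F) :=
  ⨅ i ∈ I, LinearMap.ker (LinearMap.proj i : (Fin n → F) →ₗ[F] F)

/-- Shortened code at a set `I` of positions. -/
def shorten {n : ℕ} (I : Set (Fin n)) (C : Submodule F (Fin n → F)) :
    Submodule F ({i : Fin n // i ∉ I} → F) :=
  punct I (C ⊓ zeroOn I)

/-- The dot product with a fixed vector, as a linear map. -/
def dotLin {n : ℕ} (c : Fin n → F) : (Fin n → F) →ₗ[F] F where
  toFun v := ∑ i, c i * v i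
  map_add' a b := by simp [mul_add, Finset.sum_add_distrib]
  map_smul' r v := by simp [Finset.mul_sum, mul_left_comm]

/-- Dual code with respect to the standard bilinear form. -/
def dualCode {n : ℕ} (C : Submodule F (Fin n → F)) : Submodule F (Fin n → F) :=
  ⨅ c ∈ C, LinearMap.ker (dotLin c)

theorem GRSmap_apply_aux {ι : Type*} (x y : ι → F) (p : F[X]) (i : ι) :
    GRSmap x y p i = y i * p.eval (x i) := by
  simp [GRSmap, Polynomial.aeval_def, Polynomial.eval₂_eq_eval_map]

/-- The square of a GRS code of dimension `k` is the GRS code of dimension `2k-1`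
with squared multipliers. -/
theorem stmt1 [Fintype F] {n k : ℕ} (hk : 1 ≤ k) (hkn : k < n) (hnq : n ≤ Fintype.card F)
    (x y : Fin n → F) (hx : Function.Injective x) (hy : ∀ i, y i ≠ 0)
    (h2k : 2 * k - 1 ≤ n) :
    starProd (GRS k x y) (GRS k x y) = GRS (2 * k - 1) x (y * y) := by
  apply le_antisymm
  · refine Submodule.span_le.2 ?_
    rintro v ⟨a, ⟨p, hp, rfl⟩, b, ⟨r, hr, rfl⟩, rfl⟩
    refine ⟨p * r, ?_, ?_⟩
    · have hp' := Polynomial.mem_degreeLT.1 hp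
      have hr' := Polynomial.mem_degreeLT.1 hr
      refine Polynomial.mem_degreeLT.2 ?_
      by_cases hp0 : p = 0
      · subst hp0
        rw [zero_mul, Polynomial.degree_zero]
        exact WithBot.bot_lt_coe _
      by_cases hr0 : r = 0
      · subst hr0
        rw [mul_zero, Polynomial.degree_zero]
        exact WithBot.bot_lt_coe _
      rw [← Polynomial.natDegree_lt_iff_degree_lt hp0] at hp'
      rw [← Polynomial.natDegree_lt_iff_degree_lt hr0] at hr'
      rw [← Polynomial.natDegree_lt_iff_degree_lt (mul_ne_zero hp0 hr0),
        Polynomial.natDegree_mul hp0 hr0]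
      omega
    · funext i
      simp only [GRSmap_apply_aux, Pi.mul_apply, Polynomial.eval_mul]
      ring
  · classical
    unfold GRS
    rw [Submodule.map_le_iff_le_comap, Polynomial.degreeLT_eq_span_X_pow, Submodule.span_le]
    intro p hp
    simp only [Finset.coe_image, Finset.coe_range, Set.mem_image, Set.mem_Iio] at hp
    obtain ⟨j, hj, rfl⟩ := hp
    have key : ∀ a : ℕ, a < k →
        GRSmap x y (X ^ a) ∈ (Polynomial.degreeLT F k).map (GRSmap x y) := by
      intro a ha
      refine Submodule.mem_map_of_mem (Polynomial.mem_degreeLT.2 ?_)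
      rw [Polynomial.degree_X_pow]
      exact_mod_cast ha
    refine Submodule.subset_span ⟨_, key (min j (k - 1)) (by omega), _,
      key (j - min j (k - 1)) (by omega), ?_⟩
    funext i
    simp only [GRSmap_apply_aux, Pi.mul_apply, Polynomial.eval_pow, Polynomial.eval_X]
    have e : j = min j (k - 1) + (j - min j (k - 1)) := by omega
    conv_lhs => rw [e, pow_add]
    ring
end
end

section
/- Let n - k ≥ 4 (equivalently k ≤ n - 4) and let x be an n-tuple of distinct elements of F_q, y ∈ (F_q^×)^n. Let a, b ∈ F_q with a ≠ b, λ ∈ F_q^×, and define F = {(y_i P(x_i))_{1≤i≤n} : deg P < n-k, P(a) = λ P(b)} ⊆ GRS_{n-k}(x,y). Then the square code F² equals {(y_i² P(x_i))_{1≤i≤n} : deg P < 2(n-k)-1, P(a) = λ² P(b)}; in particular F² is a codimension-1 subcode of GRS_{2(n-k)-1}(x, y⋆y). -/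
open Polynomial Matrix

noncomputable section

variable {F : Type*} [Field F]

/-- Polynomials of degree `< m` satisfying `P(a) = λ P(b)`. -/
def polyCond (m : ℕ) (a b lam : F) : Submodule F F[X] :=
  Polynomial.degreeLT F m ⊓
    LinearMap.ker ((Polynomial.aeval a).toLinearMap - lam • (Polynomial.aeval b).toLinearMap)

theorem mem_polyCond_aux (m : ℕ) (a b lam : F) (P : F[X]) :
    P ∈ polyCond m a b lam ↔ P.degree < m ∧ P.eval a = lam * P.eval b := by
  simp [polyCond, Polynomial.mem_degreeLT, sub_eq_zero, Polynomial.aeval_def, Polynomial.eval₂_eq_eval_map]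

theorem GRSmap_mul_aux {ι : Type*} (x y : ι → F) (P Q : F[X]) :
    GRSmap x (y * y) (P * Q) = GRSmap x y P * GRSmap x y Q := by
  funext i
  simp [GRSmap]
  ring

theorem factor_aux (a b : F) (hab : a ≠ b) (d : ℕ) (P : F[X]) (hd : P.degree < (d + 2 : ℕ))
    (ha : P.eval a = 0) (hb : P.eval b = 0) :
    ∃ Q : F[X], P = (X - C a) * (X - C b) * Q ∧ Q.degree < d := by
  have hcop : IsCoprime (X - C a) (X - C b) := Polynomial.isCoprime_X_sub_C_of_isUnit_sub
    (sub_ne_zero.2 hab).isUnit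
  obtain ⟨Q, hQ⟩ := hcop.mul_dvd (Polynomial.dvd_iff_isRoot.2 ha) (Polynomial.dvd_iff_isRoot.2 hb)
  refine ⟨Q, hQ, ?_⟩
  by_cases h0 : Q = 0
  · simp [h0]
  · rw [hQ, Polynomial.degree_mul, Polynomial.degree_mul, degree_X_sub_C, degree_X_sub_C,
      Polynomial.degree_eq_natDegree h0] at hd
    rw [Polynomial.degree_eq_natDegree h0]
    norm_cast at hd ⊢
    omega

theorem degree_Z_mul_aux (a b : F) (d : ℕ) (Q : F[X]) (hQ : Q.degree < d) :
    ((X - C a) * (X - C b) * Q).degree < ((d + 2 : ℕ) : WithBot ℕ) := by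
  by_cases h0 : Q = 0
  · rw [h0, mul_zero, Polynomial.degree_zero]; exact WithBot.bot_lt_coe _
  · rw [Polynomial.degree_mul, Polynomial.degree_mul, degree_X_sub_C, degree_X_sub_C]
    rw [Polynomial.degree_eq_natDegree h0] at hQ ⊢
    norm_cast at hQ ⊢
    omega

theorem interp_aux (a b : F) (hab : a ≠ b) (u v : F) :
    ∃ l : F[X], l.degree < (2 : ℕ) ∧ l.eval a = u ∧ l.eval b = v := by
  have h := sub_ne_zero.2 hab
  refine ⟨C ((u - v) / (a - b)) * X + C (v - (u - v) / (a - b) * b), ?_, ?_, ?_⟩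
  · exact lt_of_le_of_lt Polynomial.degree_linear_le (by norm_cast)
  · simp
    field_simp
    ring
  · simp

theorem degree_mul_lt_aux (P Q : F[X]) (c d e : ℕ) (hP : P.degree < c) (hQ : Q.degree < d)
    (h : c + d ≤ e + 1) : (P * Q).degree < e := by
  by_cases h0 : P = 0
  · simp [h0]
  by_cases h1 : Q = 0
  · simp [h1]
  rw [Polynomial.degree_mul]
  rw [Polynomial.degree_eq_natDegree h0] at *
  rw [Polynomial.degree_eq_natDegree h1] at *
  norm_cast at *
  omega

theorem poly_aux (m : ℕ) (hm : 4 ≤ m) (a b lam : F) (hab : a ≠ b) (hlam : lam ≠ 0)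
    (N : Submodule F F[X])
    (hN : ∀ P ∈ polyCond m a b lam, ∀ Q ∈ polyCond m a b lam, P * Q ∈ N)
    (P : F[X]) (hP : P ∈ polyCond (2 * m - 1) a b (lam ^ 2)) : P ∈ N := by
  obtain ⟨j, rfl⟩ : ∃ j, m = j + 4 := ⟨m - 4, by omega⟩
  rw [mem_polyCond_aux] at hP
  obtain ⟨hPd, hPe⟩ := hP
  obtain ⟨l, hl, hla, hlb⟩ := interp_aux a b hab lam 1
  have hlV : l ∈ polyCond (j + 4) a b lam := by
    rw [mem_polyCond_aux, hla, hlb]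
    exact ⟨hl.trans_le (by norm_cast; omega), by ring⟩
  have hZV : ∀ Q : F[X], Q.degree < (j + 2 : ℕ) →
      (X - C a) * (X - C b) * Q ∈ polyCond (j + 4) a b lam := by
    intro Q hQ
    rw [mem_polyCond_aux]
    exact ⟨degree_Z_mul_aux a b _ Q hQ, by simp⟩
  have hl2 : (l * l).degree < (3 : ℕ) := degree_mul_lt_aux _ _ 2 2 3 hl hl (by omega)
  obtain ⟨Q, hQ, hQd⟩ := factor_aux a b hab (2 * j + 5) (P - C (P.eval b) * (l * l))
    (by
      refine lt_of_le_of_lt (Polynomial.degree_sub_le _ _) (max_lt ?_ ?_)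
      · exact hPd.trans_le (by norm_cast)
      · refine degree_mul_lt_aux _ _ 1 3 _ ?_ hl2 (by omega)
        exact lt_of_le_of_lt Polynomial.degree_C_le (by norm_cast))
    (by simp [hla, hPe]; ring) (by simp [hlb])
  obtain ⟨r, hr, hra, hrb⟩ := interp_aux a b hab (Q.eval a / lam) (Q.eval b)
  obtain ⟨S, hS, hSd⟩ := factor_aux a b hab (2 * j + 3) (Q - r * l)
    (by
      refine lt_of_le_of_lt (Polynomial.degree_sub_le _ _) (max_lt hQd ?_)
      exact degree_mul_lt_aux _ _ 2 2 _ hr hl (by omega))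
    (by simp [hla, hra, hlam]) (by simp [hlb, hrb])
  have key : P = P.eval b • (l * l) + ((X - C a) * (X - C b) * r) * l
      + ∑ i ∈ Finset.range (2 * j + 3), S.coeff i •
        (((X - C a) * (X - C b) * X ^ (min i (j + 1))) *
          ((X - C a) * (X - C b) * X ^ (i - min i (j + 1)))) := by
    have hSs : S = ∑ i ∈ Finset.range (2 * j + 3), C (S.coeff i) * X ^ i := by
      by_cases h0 : S = 0
      · simp [h0]
      · exact Polynomial.as_sum_range_C_mul_X_pow' S
          ((Polynomial.natDegree_lt_iff_degree_lt h0).2 hSd)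
    have h2 : ∑ i ∈ Finset.range (2 * j + 3), S.coeff i •
        (((X - C a) * (X - C b) * X ^ (min i (j + 1))) *
          ((X - C a) * (X - C b) * X ^ (i - min i (j + 1)))) =
        ((X - C a) * (X - C b)) * ((X - C a) * (X - C b)) * S := by
      conv_rhs => rw [hSs]
      rw [Finset.mul_sum]
      refine Finset.sum_congr rfl fun i _ => ?_
      have : (X : F[X]) ^ i = X ^ (min i (j + 1)) * X ^ (i - min i (j + 1)) := by
        rw [← pow_add]; congr 1; omega
      rw [this, Polynomial.smul_eq_C_mul]
      ring
    rw [h2, Polynomial.smul_eq_C_mul]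
    linear_combination hQ + (X - C a) * (X - C b) * hS
  rw [key]
  refine N.add_mem (N.add_mem (N.smul_mem _ (hN _ hlV _ hlV)) (hN _ (hZV r ?_) _ hlV)) ?_
  · exact hr.trans_le (by norm_cast; omega)
  · refine N.sum_mem fun i hi => N.smul_mem _ (hN _ (hZV _ ?_) _ (hZV _ ?_))
    · rw [Polynomial.degree_X_pow]; norm_cast; omega
    · rw [Finset.mem_range] at hi
      rw [Polynomial.degree_X_pow]; norm_cast; omega

/-- The square of the subcode `F = {(y_i P(x_i)) : deg P < n-k, P(a) = λ P(b)}` of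
`GRS_{n-k}(x,y)` is `{(y_i² P(x_i)) : deg P < 2(n-k)-1, P(a) = λ² P(b)}`. -/
theorem stmt9 [Fintype F] {n k : ℕ} (hk2 : k ≤ n) (hnk : 4 ≤ n - k)
    (hdim : 2 * (n - k) - 1 ≤ n) (hq : n ≤ Fintype.card F)
    (x y : Fin n → F) (hx : Function.Injective x) (hy : ∀ i, y i ≠ 0)
    (a b lam : F) (hab : a ≠ b) (hlam : lam ≠ 0) :
    starProd ((polyCond (n - k) a b lam).map (GRSmap x y))
        ((polyCond (n - k) a b lam).map (GRSmap x y)) =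
      (polyCond (2 * (n - k) - 1) a b (lam ^ 2)).map (GRSmap x (y * y)) := by
  apply le_antisymm
  · refine Submodule.span_le.2 ?_
    rintro v ⟨_, ⟨P, hP, rfl⟩, _, ⟨Q, hQ, rfl⟩, rfl⟩
    refine ⟨P * Q, ?_, GRSmap_mul_aux x y P Q⟩
    rw [SetLike.mem_coe, mem_polyCond_aux] at *
    refine ⟨degree_mul_lt_aux P Q _ _ _ hP.1 hQ.1 (by omega), ?_⟩
    rw [Polynomial.eval_mul, Polynomial.eval_mul, hP.2, hQ.2]
    ring
  · rw [Submodule.map_le_iff_le_comap]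
    intro P hP
    refine poly_aux (n - k) hnk a b lam hab hlam _ ?_ P hP
    intro A hA B hB
    rw [Submodule.mem_comap, GRSmap_mul_aux]
    exact Submodule.subset_span ⟨_, ⟨A, hA, rfl⟩, _, ⟨B, hB, rfl⟩, rfl⟩
end
end
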